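/- arXiv:1910.10665 — 2 statements merged into one kernel-verified Lean document; each statement's English description precedes it below -/
import Mathlib

section
/- Let G = (S ∪ 𝒯, E) be a finite multigraph whose terminals 𝒯 are degree-one vertices adjacent to S, let c ≥ 0 be an integer, and let X ⊆ S be connectivity-c linked in G. Then G/X is a connectivity-c mimicking network for (G,𝒯); that is, for every pair of disjoint subsets A, B ⊆ 𝒯, mincut^c_{G/X}(A,B) = mincut^c_G(A,B). -/
/-- A multigraph on vertex type `V` with edge type `E`: each edge has an
unordered pair of endpoints (possibly equal, i.e. a loop). -/
structure Multigraph (V : Type) (E : Type) where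
  ends : E → Sym2 V

namespace Multigraph

variable {V E : Type}

/-- Reachability in `G` after removing the edge set `F`: there is a walk from
`a` to `b` using only edges not in `F`. -/
def Reach (G : Multigraph V E) (F : Set E) (a b : V) : Prop :=
  Relation.ReflTransGen (fun x y => ∃ e, e ∉ F ∧ G.ends e = s(x, y)) a b

/-- The edge set `F` separates `A` from `B` in `G`. -/
def Separates (G : Multigraph V E) (F : Set E) (A B : Set V) : Prop :=
  ∀ a ∈ A, ∀ b ∈ B, ¬ G.Reach F a b

/-- The minimum number of edges whose removal leaves no path from `A` to `B`
(`0` if `A` or `B` is empty). -/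
noncomputable def mincut (G : Multigraph V E) (A B : Set V) : ℕ :=
  sInf {n | ∃ F : Finset E, G.Separates ↑F A B ∧ F.card = n}

/-- The thresholded minimum cut `min(mincut, c)`. -/
noncomputable def mincutC (G : Multigraph V E) (c : ℕ) (A B : Set V) : ℕ :=
  min (G.mincut A B) c

/-- `E_G(A,B)`: the edges with one endpoint in `A` and the other in `B`. -/
def edgesBetween (G : Multigraph V E) (A B : Set V) : Set E :=
  {e | ∃ a ∈ A, ∃ b ∈ B, G.ends e = s(a, b)}

/-- `∂(X)`: the boundary edges of `X`. -/
def bdry (G : Multigraph V E) (X : Set V) : Set E :=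
  G.edgesBetween X Xᶜ

/-- The edges of the induced subgraph `G[X]` (both endpoints in `X`). -/
def edgesIn (G : Multigraph V E) (X : Set V) : Set E :=
  {e | ∀ v ∈ G.ends e, v ∈ X}

/-- Reachability inside the induced subgraph `G[U]`, avoiding removed edges `F`. -/
def ReachIn (G : Multigraph V E) (U : Set V) (F : Set E) (a b : V) : Prop :=
  Relation.ReflTransGen
    (fun x y => x ∈ U ∧ y ∈ U ∧ ∃ e, e ∉ F ∧ G.ends e = s(x, y)) a b

/-- `G = (S ∪ 𝒯, E)`: the vertex set is partitioned into `S` and the terminal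
set `T`, and each terminal is a degree-one vertex adjacent to a vertex of `S`. -/
def TerminalSetup (G : Multigraph V E) (S T : Set V) : Prop :=
  Disjoint S T ∧ S ∪ T = Set.univ ∧
    ∀ t ∈ T, ∃ e, ∃ u ∈ S, G.ends e = s(t, u) ∧ ∀ e', t ∈ G.ends e' → e' = e

/-- `X` is connectivity-`c` linked in `G`: for every partition of `X` into
disjoint sets `A` and `B`,
`|E_G(A,B)| ≥ min(|∂(A) ∩ ∂(X)|, |∂(B) ∩ ∂(X)|, c)`. -/
def Linked (G : Multigraph V E) (c : ℕ) (X : Set V) : Prop :=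
  ∀ A B : Set V, Disjoint A B → A ∪ B = X →
    min (min ((G.bdry A ∩ G.bdry X).ncard) ((G.bdry B ∩ G.bdry X).ncard)) c ≤
      (G.edgesBetween A B).ncard

end Multigraph

namespace Multigraph

/-- The setoid on `V` identifying the endpoints of every edge of `G[X]`. -/
def contractSetoid {V E : Type} (G : Multigraph V E) (X : Set V) : Setoid V :=
  ⟨Relation.EqvGen (fun a b => a ∈ X ∧ b ∈ X ∧ ∃ e, G.ends e = s(a, b)),
    Relation.EqvGen.is_equivalence _⟩

/-- `G/X`: the multigraph obtained from `G` by contracting every edge of the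
induced subgraph `G[X]` (keeping parallel edges). -/
def contract {V E : Type} (G : Multigraph V E) (X : Set V) :
    Multigraph (Quotient (G.contractSetoid X)) E where
  ends := fun e => (G.ends e).map (Quotient.mk (G.contractSetoid X))

end Multigraph

namespace Multigraph

lemma mem_bdry_iff {V E : Type} {G : Multigraph V E} {e : E} {u v : V}
    (h : G.ends e = s(u, v)) (P : Set V) : e ∈ G.bdry P ↔ ¬ (u ∈ P ↔ v ∈ P) := by
  simp only [bdry, edgesBetween, Set.mem_ofPred_eq, h, Sym2.eq_iff, Set.mem_compl_iff]
  grind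

lemma bdry_compl {V E : Type} (G : Multigraph V E) (P : Set V) : G.bdry Pᶜ = G.bdry P := by
  ext e
  obtain ⟨⟨u, v⟩, h⟩ := Quot.exists_rep (G.ends e)
  have h' : G.ends e = s(u, v) := h.symm
  rw [mem_bdry_iff h', mem_bdry_iff h', Set.mem_compl_iff, Set.mem_compl_iff, not_iff_not, not_iff_not]

lemma edgesBetween_comm {V E : Type} (G : Multigraph V E) (P Q : Set V) :
    G.edgesBetween P Q = G.edgesBetween Q P := by
  ext e
  constructor <;> rintro ⟨a, ha, b, hb, h⟩ <;> exact ⟨b, hb, a, ha, h.trans Sym2.eq_swap⟩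

lemma separates_bdry {V E : Type} (G : Multigraph V E) {P A B : Set V} (hA : A ⊆ P)
    (hB : Disjoint B P) : G.Separates (G.bdry P) A B := by
  intro a ha b hb h
  refine Set.disjoint_left.mp hB hb ?_
  clear hb
  induction h with
  | refl => exact hA ha
  | tail _ hstep ih =>
    obtain ⟨e, he, hends⟩ := hstep
    rw [mem_bdry_iff hends, not_not] at he
    exact he.mp ih

lemma mincut_le_ncard_bdry {V E : Type} [Finite E] (G : Multigraph V E) {P A B : Set V}
    (hA : A ⊆ P) (hB : Disjoint B P) : G.mincut A B ≤ (G.bdry P).ncard := by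
  refine Nat.sInf_le ⟨(Set.toFinite (G.bdry P)).toFinset, ?_, ?_⟩
  · simpa using G.separates_bdry hA hB
  · exact (Set.ncard_eq_toFinset_card _ _).symm

lemma exists_ncard_bdry_le_mincut {V E : Type} [Finite E] (G : Multigraph V E) {A B : Set V}
    (hAB : Disjoint A B) :
    ∃ P, A ⊆ P ∧ Disjoint B P ∧ (G.bdry P).ncard ≤ G.mincut A B := by
  have hne : {n | ∃ F : Finset E, G.Separates ↑F A B ∧ F.card = n}.Nonempty :=
    ⟨_, (Set.toFinite (G.bdry A)).toFinset,
      by simpa using G.separates_bdry subset_rfl hAB.symm, rfl⟩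
  obtain ⟨F, hF, hcard⟩ := Nat.sInf_mem hne
  refine ⟨{v | ∃ a ∈ A, G.Reach F a v}, fun a ha => ⟨a, ha, .refl⟩,
    Set.disjoint_left.mpr fun b hb ⟨a, ha, h⟩ => hF a ha b hb h, ?_⟩
  rw [mincut, ← hcard, ← Set.ncard_coe_finset]
  refine Set.ncard_le_ncard ?_ (Set.toFinite _)
  rintro e ⟨u, ⟨a, ha, hu⟩, v, hv, hends⟩
  by_contra he
  exact hv ⟨a, ha, hu.tail ⟨e, he, hends⟩⟩

/-- If at most as many boundary edges of `X` leave `X ∩ P` as there are edges from `X ∩ P` to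
`X \ P`, then removing `X` from `P` does not increase the boundary. -/
lemma ncard_bdry_diff_le {V E : Type} [Finite E] (G : Multigraph V E) (X P : Set V)
    (h : (G.bdry (X ∩ P) ∩ G.bdry X).ncard ≤ (G.edgesBetween (X ∩ P) (X \ P)).ncard) :
    (G.bdry (P \ X)).ncard ≤ (G.bdry P).ncard := by
  have hsub : G.edgesBetween (X ∩ P) (X \ P) ⊆ G.bdry P := by
    rintro e ⟨u, hu, v, hv, hends⟩
    exact ⟨u, hu.2, v, hv.2, hends⟩
  have hcover : G.bdry (P \ X) ⊆
      (G.bdry P \ G.edgesBetween (X ∩ P) (X \ P)) ∪ (G.bdry (X ∩ P) ∩ G.bdry X) := by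
    rintro e ⟨u, hu, v, hv, hends⟩
    simp only [Set.mem_union, Set.mem_sdiff, Set.mem_inter_iff, mem_bdry_iff hends, edgesBetween,
      Set.mem_ofPred_eq, hends, Sym2.eq_iff, Set.mem_compl_iff] at hu hv ⊢
    grind
  have h₁ := Set.ncard_le_ncard hcover (Set.toFinite _)
  have h₂ := Set.ncard_union_le (G.bdry P \ G.edgesBetween (X ∩ P) (X \ P))
    (G.bdry (X ∩ P) ∩ G.bdry X)
  have h₃ := Set.ncard_sdiff_add_ncard_of_subset hsub (Set.toFinite _)
  omega

lemma mem_iff_of_contractSetoid {V E : Type} (G : Multigraph V E) {X P : Set V}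
    (hP : X ⊆ P ∨ Disjoint P X) {u v : V}
    (h : Quotient.mk (G.contractSetoid X) u = Quotient.mk (G.contractSetoid X) v) :
    u ∈ P ↔ v ∈ P := by
  have h' : Relation.EqvGen (fun a b => a ∈ X ∧ b ∈ X ∧ ∃ e, G.ends e = s(a, b)) u v :=
    Quotient.exact h
  clear h
  induction h' with
  | rel a b hab =>
    rcases hP with hP | hP
    · exact iff_of_true (hP hab.1) (hP hab.2.1)
    · exact iff_of_false (Set.disjoint_right.mp hP hab.1) (Set.disjoint_right.mp hP hab.2.1)
  | refl => exact Iff.rfl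
  | symm _ _ _ ih => exact ih.symm
  | trans _ _ _ _ _ ih₁ ih₂ => exact ih₁.trans ih₂

lemma bdry_preimage_mk {V E : Type} (G : Multigraph V E) (X : Set V)
    (Q : Set (Quotient (G.contractSetoid X))) :
    G.bdry (Quotient.mk (G.contractSetoid X) ⁻¹' Q) = (G.contract X).bdry Q := by
  ext e
  obtain ⟨⟨u, v⟩, h⟩ := Quot.exists_rep (G.ends e)
  have h' : G.ends e = s(u, v) := h.symm
  have hc : (G.contract X).ends e =
      s(Quotient.mk (G.contractSetoid X) u, Quotient.mk (G.contractSetoid X) v) := by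
    simp [contract, h']
  rw [mem_bdry_iff h', mem_bdry_iff hc, Set.mem_preimage, Set.mem_preimage]

lemma preimage_image_mk {V E : Type} (G : Multigraph V E) {X P : Set V}
    (hP : X ⊆ P ∨ Disjoint P X) :
    Quotient.mk (G.contractSetoid X) ⁻¹' (Quotient.mk (G.contractSetoid X) '' P) = P := by
  refine Set.Subset.antisymm ?_ (Set.subset_preimage_image _ _)
  rintro v ⟨u, hu, huv⟩
  exact (G.mem_iff_of_contractSetoid hP huv).mp hu

lemma disjoint_image_mk {V E : Type} (G : Multigraph V E) {X P B : Set V}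
    (hP : X ⊆ P ∨ Disjoint P X) (hB : Disjoint B P) :
    Disjoint (Quotient.mk (G.contractSetoid X) '' B) (Quotient.mk (G.contractSetoid X) '' P) := by
  rw [Set.disjoint_left]
  rintro _ ⟨b, hb, rfl⟩ ⟨p, hp, hpb⟩
  exact Set.disjoint_left.mp hB hb ((G.mem_iff_of_contractSetoid hP hpb).mp hp)

lemma mincut_contract_le_ncard_bdry {V E : Type} [Finite E] (G : Multigraph V E)
    {X P A B : Set V} (hP : X ⊆ P ∨ Disjoint P X) (hA : A ⊆ P) (hB : Disjoint B P) :
    (G.contract X).mincut (Quotient.mk (G.contractSetoid X) '' A)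
      (Quotient.mk (G.contractSetoid X) '' B) ≤ (G.bdry P).ncard := by
  have h := (G.contract X).mincut_le_ncard_bdry (Set.image_mono hA) (G.disjoint_image_mk hP hB)
  rwa [← bdry_preimage_mk, G.preimage_image_mk hP] at h

lemma mincut_le_mincut_contract {V E : Type} [Finite E] (G : Multigraph V E) {X A B : Set V}
    (hAX : Disjoint A X) (hAB : Disjoint A B) :
    G.mincut A B ≤ (G.contract X).mincut (Quotient.mk (G.contractSetoid X) '' A)
      (Quotient.mk (G.contractSetoid X) '' B) := by
  obtain ⟨Q, hAQ, hBQ, hQ⟩ := (G.contract X).exists_ncard_bdry_le_mincut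
    (G.disjoint_image_mk (.inr hAX) hAB.symm).symm
  rw [← bdry_preimage_mk] at hQ
  refine (G.mincut_le_ncard_bdry (Set.image_subset_iff.mp hAQ) ?_).trans hQ
  exact Set.disjoint_left.mpr fun b hb =>
    Set.disjoint_left.mp hBQ (Set.mem_image_of_mem _ hb)

/-- A cut of size less than `c` can be moved off a connectivity-`c` linked set without growing. -/
lemma Linked.mincut_contract_le {V E : Type} [Finite E] {G : Multigraph V E} {c : ℕ}
    {X A B : Set V} (hX : G.Linked c X) (hAX : Disjoint A X) (hBX : Disjoint B X)
    (hAB : Disjoint A B) (hc : G.mincut A B < c) :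
    (G.contract X).mincut (Quotient.mk (G.contractSetoid X) '' A)
      (Quotient.mk (G.contractSetoid X) '' B) ≤ G.mincut A B := by
  obtain ⟨P, hAP, hBP, hP⟩ := G.exists_ncard_bdry_le_mincut hAB
  have hlt : (G.edgesBetween (X ∩ P) (X \ P)).ncard < c := by
    refine lt_of_le_of_lt (Set.ncard_le_ncard ?_ (Set.toFinite _)) (hP.trans_lt hc)
    rintro e ⟨u, hu, v, hv, hends⟩
    exact ⟨u, hu.2, v, hv.2, hends⟩
  have hlink := hX (X ∩ P) (X \ P) (Set.disjoint_sdiff_inter.symm) (Set.inter_union_sdiff X P)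
  rw [min_le_iff, min_le_iff, or_iff_left (not_le.mpr hlt)] at hlink
  refine le_trans ?_ hP
  rcases hlink with h | h
  · exact (G.mincut_contract_le_ncard_bdry (.inr Set.disjoint_sdiff_left)
      (Set.subset_sdiff.mpr ⟨hAP, hAX⟩) (hBP.mono_right Set.sdiff_subset)).trans
      (G.ncard_bdry_diff_le X P h)
  · have hcompl : (G.bdry (Pᶜ \ X)).ncard ≤ (G.bdry Pᶜ).ncard := by
      refine G.ncard_bdry_diff_le X Pᶜ ?_
      rwa [← Set.sdiff_eq, Set.sdiff_compl, edgesBetween_comm]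
    have hunion : (Pᶜ \ X)ᶜ = P ∪ X := by rw [Set.sdiff_eq, ← Set.compl_union, compl_compl]
    rw [← bdry_compl, G.bdry_compl P, hunion] at hcompl
    exact (G.mincut_contract_le_ncard_bdry (.inl Set.subset_union_right)
      (hAP.trans Set.subset_union_left) (Set.disjoint_union_right.mpr ⟨hBP, hBX⟩)).trans hcompl

end Multigraph

/-- If `X ⊆ S` is connectivity-`c` linked in `G`, then `G/X` is a
connectivity-`c` mimicking network for `(G, T)`. -/
theorem stmt_2 {V E : Type} [Fintype V] [Fintype E] (G : Multigraph V E)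
    (S T : Set V) (hG : G.TerminalSetup S T) (c : ℕ)
    (X : Set V) (hXS : X ⊆ S) (hX : G.Linked c X) :
    ∀ A B : Set V, A ⊆ T → B ⊆ T → Disjoint A B →
      (G.contract X).mincutC c
          (Quotient.mk (G.contractSetoid X) '' A)
          (Quotient.mk (G.contractSetoid X) '' B)
        = G.mincutC c A B := by
  intro A B hA hB hAB
  have hTX : Disjoint T X := hG.1.symm.mono_right hXS
  have hge := G.mincut_le_mincut_contract (hTX.mono_left hA) hAB
  have hle := hX.mincut_contract_le (hTX.mono_left hA) (hTX.mono_left hB) hAB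
  unfold Multigraph.mincutC
  omega
end

section
/- Let G = (S ∪ 𝒯, E) be a finite multigraph whose terminals 𝒯 are degree-one vertices adjacent to S, let c ≥ 0 be an integer, and let X ⊆ S be connectivity-c linked in G. Then for every integer ℓ ≤ c and every pair of disjoint edge sets E_in, E_out ⊆ ∂(X) with |E_in| = |E_out| = ℓ, there exist ℓ pairwise edge-disjoint paths, each of which starts with an edge of E_in, ends with an edge of E_out, and uses only edges of G[X] ∪ ∂(X), such that each edge of E_in and each edge of E_out is used by exactly one of the paths. -/
namespace Multigraph

/-- A walk in a multigraph: an alternating sequence of vertices and edges in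
which consecutive vertices are the endpoints of the corresponding edge. -/
structure Walk {V E : Type} (G : Multigraph V E) where
  verts : List V
  edges : List E
  hlen : verts.length = edges.length + 1
  hvalid : ∀ i (hi : i < edges.length),
    G.ends (edges[i]'hi) = s(verts[i]'(by omega), verts[i + 1]'(by omega))

end Multigraph

/-- If `f` is injective on `W \ B` and maps it off `A`, then two orbits starting in `A` and
stopped on reaching `B` can only meet if they have the same start, and then at the same time. -/
theorem iterate_eq_iterate_of_injOn {α : Type*} {f : α → α} {A B W : Set α}
    (hf : Set.InjOn f (W \ B)) (hmaps : Set.MapsTo f (W \ B) (W \ A)) (hAW : A ⊆ W)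
    {a b : α} (ha : a ∈ A) (hb : b ∈ A) {i j : ℕ}
    (hi : ∀ k < i, f^[k] a ∉ B) (hj : ∀ k < j, f^[k] b ∉ B) (h : f^[i] a = f^[j] b) :
    a = b ∧ i = j := by
  have mem : ∀ {c : α}, c ∈ A → ∀ n, (∀ k < n, f^[k] c ∉ B) → f^[n] c ∈ W := by
    intro c hc n
    induction n with
    | zero => intro _; exact hAW hc
    | succ n ih =>
      intro hn
      rw [Function.iterate_succ_apply']
      exact (hmaps ⟨ih fun k hk => hn k (by omega), hn n (by omega)⟩).1
  have notMem : ∀ {c : α}, c ∈ A → ∀ n, (∀ k < n + 1, f^[k] c ∉ B) → f^[n + 1] c ∉ A := by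
    intro c hc n hn
    rw [Function.iterate_succ_apply']
    exact (hmaps ⟨mem hc n fun k hk => hn k (by omega), hn n (by omega)⟩).2
  induction i generalizing j with
  | zero =>
    cases j with
    | zero => exact ⟨h, rfl⟩
    | succ j => exact absurd (h ▸ ha) (notMem hb j hj)
  | succ i ih =>
    cases j with
    | zero => exact absurd (h ▸ hb) (notMem ha i hi)
    | succ j =>
      have hi' : ∀ k < i, f^[k] a ∉ B := fun k hk => hi k (by omega)
      have hj' : ∀ k < j, f^[k] b ∉ B := fun k hk => hj k (by omega)
      rw [Function.iterate_succ_apply', Function.iterate_succ_apply'] at h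
      obtain ⟨h₁, h₂⟩ := ih hi' hj' <|
        hf ⟨mem ha i hi', hi i (by omega)⟩ ⟨mem hb j hj', hj j (by omega)⟩ h
      exact ⟨h₁, by rw [h₂]⟩

/-- If `f` is injective on `W \ B` and maps it to `W \ A`, then every orbit starting in `A`
reaches `B`. -/
theorem exists_iterate_mem_of_injOn {α : Type*} [Finite α] {f : α → α} {A B W : Set α}
    (hf : Set.InjOn f (W \ B)) (hmaps : Set.MapsTo f (W \ B) (W \ A)) (hAW : A ⊆ W)
    {a : α} (ha : a ∈ A) : ∃ n, f^[n] a ∈ B := by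
  by_contra! h
  exact not_injective_infinite_finite (fun n => f^[n] a) fun i j hij =>
    (iterate_eq_iterate_of_injOn hf hmaps hAW ha ha (fun k _ => h k) (fun k _ => h k) hij).2

namespace Multigraph

variable {V E : Type}

namespace Walk

/-- The walk along a single edge. -/
def single (G : Multigraph V E) {e : E} {x y : V} (h : G.ends e = s(x, y)) : G.Walk where
  verts := [x, y]
  edges := [e]
  hlen := rfl
  hvalid i hi := by
    obtain rfl : i = 0 := by simpa using hi
    simpa using h

/-- Prepend an edge to a walk. -/
def cons {G : Multigraph V E} (w : G.Walk) {e : E} {x y : V} (h : G.ends e = s(x, y))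
    (hy : w.verts.head? = some y) : G.Walk where
  verts := x :: w.verts
  edges := e :: w.edges
  hlen := by simp [w.hlen]
  hvalid i hi := by
    cases i with
    | zero =>
      have : w.verts[0]'(by have := w.hlen; omega) = y := by
        rw [List.head?_eq_getElem?] at hy
        exact (List.getElem?_eq_some_iff.mp hy).2
      simpa [this] using h
    | succ i => simpa using w.hvalid i (by simpa using hi)

end Walk

/-- A sequence of distinct edges in which consecutive edges share a vertex contains a walk
from any given endpoint of the first edge whose last edge is the last edge of the sequence. -/
theorem exists_walk_of_seq (G : Multigraph V E) (g : ℕ → E) (n i : ℕ)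
    (hinj : ∀ j k, j ≤ i + n → k ≤ i + n → g j = g k → j = k)
    (hadj : ∀ j < i + n, ∃ v ∈ G.ends (g j), v ∈ G.ends (g (j + 1)))
    {x : V} (hx : x ∈ G.ends (g i)) :
    ∃ w : G.Walk, w.verts.head? = some x ∧ w.edges.Nodup ∧
      (∀ e ∈ w.edges, ∃ j, i ≤ j ∧ j ≤ i + n ∧ e = g j) ∧
      w.edges.getLast? = some (g (i + n)) := by
  induction n generalizing i x with
  | zero =>
    obtain ⟨y, hy⟩ := hx
    exact ⟨Walk.single G hy, by simp [Walk.single],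
      by simp [Walk.single], by simp [Walk.single]; exact ⟨i, by simp⟩, by simp [Walk.single]⟩
  | succ n ih =>
    have hin : i + 1 + n = i + (n + 1) := by omega
    have ih' := fun {x : V} => @ih (i + 1) (by rwa [hin]) (by rwa [hin]) x
    rw [hin] at ih'
    obtain ⟨v, hv, hv'⟩ := hadj i (by omega)
    obtain ⟨w, hw₁, hw₂, hw₃, hw₄⟩ := ih' hv'
    by_cases hvx : v = x
    · subst hvx
      refine ⟨w, hw₁, hw₂, fun e he => ?_, hw₄⟩
      obtain ⟨j, h₁, h₂, h₃⟩ := hw₃ e he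
      exact ⟨j, by omega, h₂, h₃⟩
    · have hends : G.ends (g i) = s(x, v) := ((Sym2.mem_and_mem_iff (Ne.symm hvx)).mp ⟨hx, hv⟩)
      refine ⟨w.cons hends hw₁, rfl, ?_, ?_, ?_⟩
      · refine List.nodup_cons.mpr ⟨fun he => ?_, hw₂⟩
        obtain ⟨j, h₁, h₂, h₃⟩ := hw₃ _ he
        have := hinj i j (by omega) h₂ h₃
        omega
      · intro e he
        rcases List.mem_cons.mp he with rfl | he
        · exact ⟨i, le_rfl, by omega, rfl⟩
        · obtain ⟨j, h₁, h₂, h₃⟩ := hw₃ e he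
          exact ⟨j, by omega, h₂, h₃⟩
      · simp [Walk.cons, List.getLast?_cons, hw₄]

/-- A sequence of distinct edges starting with a boundary edge of `X`, in which consecutive
edges share a vertex of `X`, contains a walk with the same first and last edge. -/
theorem exists_walk_of_seq_of_mem_bdry (G : Multigraph V E) {X : Set V} (g : ℕ → E) (n : ℕ)
    (hinj : ∀ j k, j ≤ n → k ≤ n → g j = g k → j = k)
    (hadj : ∀ j < n, ∃ v ∈ X, v ∈ G.ends (g j) ∧ v ∈ G.ends (g (j + 1)))
    (h₀ : g 0 ∈ G.bdry X) :
    ∃ w : G.Walk, w.edges.Nodup ∧ (∀ e ∈ w.edges, ∃ j ≤ n, e = g j) ∧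
      w.edges.head? = some (g 0) ∧ w.edges.getLast? = some (g n) := by
  obtain ⟨a, ha, b, hb, hab⟩ := h₀
  cases n with
  | zero =>
    exact ⟨Walk.single G hab, by simp [Walk.single], by simp [Walk.single],
      by simp [Walk.single], by simp [Walk.single]⟩
  | succ n =>
    obtain ⟨v, hvX, hv, hv'⟩ := hadj 0 (by omega)
    obtain rfl : v = a := by
      rw [hab, Sym2.mem_iff] at hv
      exact hv.resolve_right fun h => hb (h ▸ hvX)
    obtain ⟨w, hw₁, hw₂, hw₃, hw₄⟩ := exists_walk_of_seq G g n 1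
      (fun j k hj hk => hinj j k (by omega) (by omega))
      (fun j hj => (hadj j (by omega)).imp fun v hv => hv.2) hv'
    refine ⟨w.cons (hab.trans Sym2.eq_swap) hw₁, ?_, ?_, rfl, ?_⟩
    · refine List.nodup_cons.mpr ⟨fun he => ?_, hw₂⟩
      obtain ⟨j, h₁, h₂, h₃⟩ := hw₃ _ he
      have := hinj 0 j (by omega) (by omega) h₃
      omega
    · intro e he
      rcases List.mem_cons.mp he with rfl | he
      · exact ⟨0, by omega, rfl⟩
      · obtain ⟨j, -, h₂, h₃⟩ := hw₃ e he
        exact ⟨j, by omega, h₃⟩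
    · simp [Walk.cons, List.getLast?_cons, hw₄, Nat.add_comm]

/-- The Hall condition for the bipartite graph encoding linkings of `Ein` onto `Eout` through
a linked set `X`. -/
theorem Linked.card_le_card_incident [Fintype E] [DecidableEq E] {G : Multigraph V E}
    {c : ℕ} {X : Set V} (hX : G.Linked c X) {Ein Eout I Z N : Finset E}
    (hI : ∀ e, e ∈ I ↔ e ∈ G.edgesIn X)
    (hin : ↑Ein ⊆ G.bdry X) (hout : ↑Eout ⊆ G.bdry X)
    (hcard : Ein.card = Eout.card) (hc : Ein.card ≤ c) (hZ : Z ⊆ I ∪ Ein)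
    (hN : ∀ f ∈ I ∪ Eout, (∃ e ∈ Z, ∃ v ∈ X, v ∈ G.ends e ∧ v ∈ G.ends f) → f ∈ N) :
    Z.card ≤ N.card := by
  classical
  have hIin : Disjoint I Ein := by
    refine Finset.disjoint_left.mpr fun e he he' => ?_
    obtain ⟨a, -, b, hb, hab⟩ := hin he'
    exact hb ((hI e).mp he b (by simp [hab]))
  have hIout : Disjoint I Eout := by
    refine Finset.disjoint_left.mpr fun e he he' => ?_
    obtain ⟨a, -, b, hb, hab⟩ := hout he'
    exact hb ((hI e).mp he b (by simp [hab]))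
  set A : Set V := {v | v ∈ X ∧ ∃ e ∈ Z, v ∈ G.ends e} with hA
  set B : Set V := X \ A with hB
  have hlink := hX A B Set.disjoint_sdiff_right (Set.union_sdiff_cancel fun v hv => hv.1)
  set L : Finset E := Finset.univ.filter fun e => e ∈ G.edgesBetween A B with hL
  have hLcard : (G.edgesBetween A B).ncard = L.card := by
    rw [← Set.ncard_coe_finset]; congr 1; ext; simp [hL]
  have hNL : ∀ f ∈ L, f ∈ I ∧ f ∈ N ∧ f ∉ Z := by
    intro f hf
    obtain ⟨a, ha, b, hb, hab⟩ : f ∈ G.edgesBetween A B := by simpa [hL] using hf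
    have hfI : f ∈ I := by
      rw [hI]
      intro v hv
      rw [hab, Sym2.mem_iff] at hv
      rcases hv with rfl | rfl
      exacts [ha.1, hb.1]
    obtain ⟨haX, e, he, hae⟩ := ha
    refine ⟨hfI, hN f (Finset.mem_union_left _ hfI) ⟨e, he, a, haX, hae, by simp [hab]⟩,
      fun hfZ => hb.2 ⟨hb.1, f, hfZ, by simp [hab]⟩⟩
  have hNI : ∀ f ∈ Z ∩ I, f ∈ N := by
    intro f hf
    obtain ⟨hfZ, hfI⟩ := Finset.mem_inter.mp hf
    have hv := Sym2.out_fst_mem (G.ends f)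
    exact hN f (Finset.mem_union_left _ hfI) ⟨f, hfZ, _, (hI f).mp hfI _ hv, hv, hv⟩
  have hmemBdry : ∀ C ⊆ X, ∀ v ∈ C, ∀ w ∉ X, ∀ e, G.ends e = s(v, w) →
      e ∈ G.bdry C ∩ G.bdry X := fun C hC v hv w hw e he =>
    ⟨⟨v, hv, w, fun h => hw (hC h), he⟩, ⟨v, hC hv, w, hw, he⟩⟩
  have hAle : (Z ∩ Ein).card ≤ (G.bdry A ∩ G.bdry X).ncard := by
    rw [← Set.ncard_coe_finset]
    refine Set.ncard_le_ncard (fun e he => ?_) (Set.toFinite _)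
    obtain ⟨heZ, he'⟩ := Finset.mem_inter.mp he
    obtain ⟨a, ha, b, hb, hab⟩ := hin he'
    exact hmemBdry A (fun v hv => hv.1) a ⟨ha, e, heZ, by simp [hab]⟩ b hb e hab
  have hBle : (Eout \ N).card ≤ (G.bdry B ∩ G.bdry X).ncard := by
    rw [← Set.ncard_coe_finset]
    refine Set.ncard_le_ncard (fun e he => ?_) (Set.toFinite _)
    obtain ⟨he', heN⟩ := Finset.mem_sdiff.mp he
    obtain ⟨a, ha, b, hb, hab⟩ := hout he'
    refine hmemBdry B Set.sdiff_subset a ⟨ha, fun haA => heN ?_⟩ b hb e hab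
    obtain ⟨-, f, hf, haf⟩ := haA
    exact hN e (Finset.mem_union_right _ he') ⟨f, hf, a, ha, haf, by simp [hab]⟩
  have hZcard : Z.card = (Z ∩ I).card + (Z ∩ Ein).card := by
    rw [← Finset.card_union_of_disjoint (hIin.mono Finset.inter_subset_right
      Finset.inter_subset_right), ← Finset.inter_union_distrib_left,
      Finset.inter_eq_left.mpr hZ]
  have hNcard : (Z ∩ I).card + L.card + (Eout ∩ N).card ≤ N.card := by
    have h₁ : Disjoint (Z ∩ I) L := Finset.disjoint_left.mpr fun f hf hf' =>
      (hNL f hf').2.2 (Finset.mem_inter.mp hf).1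
    have h₂ : Disjoint (Z ∩ I ∪ L) (Eout ∩ N) := by
      refine hIout.mono (Finset.union_subset Finset.inter_subset_right fun f hf => (hNL f hf).1)
        Finset.inter_subset_left
    rw [← Finset.card_union_of_disjoint h₁, ← Finset.card_union_of_disjoint h₂]
    exact Finset.card_le_card (Finset.union_subset
      (Finset.union_subset hNI fun f hf => (hNL f hf).2.1) Finset.inter_subset_right)
  have hEout : (Eout \ N).card + (Eout ∩ N).card = Eout.card :=
    Finset.card_sdiff_add_card_inter _ _
  have hZin : (Z ∩ Ein).card ≤ Ein.card := Finset.card_le_card Finset.inter_subset_right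
  rw [hLcard] at hlink
  omega

/-- Through a linked set `X`, there is an injection from the edges of `G[X]` and `Ein` to the
edges of `G[X]` and `Eout` that maps each edge to one sharing a vertex of `X` with it. -/
theorem Linked.exists_injOn [Fintype E] {G : Multigraph V E} {c : ℕ} {X : Set V}
    (hX : G.Linked c X) {Ein Eout : Finset E}
    (hin : ↑Ein ⊆ G.bdry X) (hout : ↑Eout ⊆ G.bdry X)
    (hcard : Ein.card = Eout.card) (hc : Ein.card ≤ c) :
    ∃ f : E → E, Set.InjOn f (G.edgesIn X ∪ Ein) ∧
      Set.MapsTo f (G.edgesIn X ∪ Ein) (G.edgesIn X ∪ Eout) ∧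
      ∀ e ∈ G.edgesIn X ∪ Ein, ∃ v ∈ X, v ∈ G.ends e ∧ v ∈ G.ends (f e) := by
  classical
  set I : Finset E := Finset.univ.filter fun e => e ∈ G.edgesIn X with hI
  have hImem : ∀ e, e ∈ I ↔ e ∈ G.edgesIn X := by simp [hI]
  let t : {e // e ∈ I ∪ Ein} → Finset E := fun e =>
    (I ∪ Eout).filter fun f => ∃ v ∈ X, v ∈ G.ends e.1 ∧ v ∈ G.ends f
  obtain ⟨f, hf, hft⟩ := (Finset.all_card_le_biUnion_card_iff_exists_injective t).mp <| by
    intro s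
    rw [← Finset.card_map (Function.Embedding.subtype _)]
    refine hX.card_le_card_incident hImem hin hout hcard hc ?_ ?_
    · exact Finset.map_subtype_subset s
    · rintro g hg ⟨e, he, hv⟩
      obtain ⟨e', he', rfl⟩ := Finset.mem_map.mp he
      exact Finset.mem_biUnion.mpr ⟨e', he', Finset.mem_filter.mpr ⟨hg, hv⟩⟩
  have hmem : ∀ {e}, e ∈ G.edgesIn X ∪ Ein → e ∈ I ∪ Ein := by
    intro e he
    simpa [hImem] using he
  refine ⟨fun e => if h : e ∈ I ∪ Ein then f ⟨e, h⟩ else e, ?_, ?_, ?_⟩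
  · intro a ha b hb hab
    simp only [hmem ha, hmem hb, dif_pos] at hab
    simpa using hf hab
  · intro e he
    have := (Finset.mem_filter.mp (hft ⟨e, hmem he⟩)).1
    simp only [hmem he, dif_pos]
    simpa [hImem] using this
  · intro e he
    simpa only [hmem he, dif_pos] using (Finset.mem_filter.mp (hft ⟨e, hmem he⟩)).2

end Multigraph

/-- If `X ⊆ S` is connectivity-`c` linked, then for every `ℓ ≤ c` and disjoint
`E_in, E_out ⊆ ∂(X)` of size `ℓ`, there are `ℓ` pairwise edge-disjoint paths in
`G[X] ∪ ∂(X)`, each starting with an edge of `E_in` and ending with an edge of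
`E_out`, with each edge of `E_in` and of `E_out` used by exactly one path. -/
theorem stmt_3 {V E : Type} [Fintype V] [Fintype E] (G : Multigraph V E)
    (S T : Set V) (hG : G.TerminalSetup S T) (c : ℕ)
    (X : Set V) (hXS : X ⊆ S) (hX : G.Linked c X)
    (ℓ : ℕ) (hlc : ℓ ≤ c) (Ein Eout : Finset E)
    (hin : ↑Ein ⊆ G.bdry X) (hout : ↑Eout ⊆ G.bdry X)
    (hdisj : Disjoint Ein Eout) (hcardin : Ein.card = ℓ) (hcardout : Eout.card = ℓ) :
    ∃ P : Fin ℓ → G.Walk,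
      (∀ i, ∃ h : (P i).edges ≠ [],
        (P i).edges.head h ∈ Ein ∧ (P i).edges.getLast h ∈ Eout) ∧
      (∀ i, ∀ e ∈ (P i).edges, e ∈ G.edgesIn X ∪ G.bdry X) ∧
      (∀ i, (P i).edges.Nodup) ∧
      (∀ i j, i ≠ j → ∀ e ∈ (P i).edges, e ∉ (P j).edges) ∧
      (∀ e ∈ Ein, ∃! i, e ∈ (P i).edges) ∧
      (∀ e ∈ Eout, ∃! i, e ∈ (P i).edges) := by
  classical
  have hnotIn : ∀ e ∈ G.bdry X, e ∉ G.edgesIn X := by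
    rintro e ⟨a, -, b, hb, hab⟩ he
    exact hb (he b (by simp [hab]))
  obtain ⟨f, hfinj, hfmaps, hfadj⟩ := hX.exists_injOn hin hout
    (hcardin.trans hcardout.symm) (hcardin.trans_le hlc)
  set W : Set E := G.edgesIn X ∪ Ein ∪ Eout with hW
  have hdiffOut : W \ Eout ⊆ G.edgesIn X ∪ Ein := fun e he => he.1.resolve_right he.2
  have hinj : Set.InjOn f (W \ Eout) := hfinj.mono hdiffOut
  have hmaps : Set.MapsTo f (W \ Eout) (W \ Ein) := by
    intro e he
    rcases hfmaps (hdiffOut he) with h | h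
    · exact ⟨Or.inl (Or.inl h), fun h' => hnotIn _ (hin h') h⟩
    · exact ⟨Or.inr h, fun h' => Finset.disjoint_left.mp hdisj h' h⟩
  have hEinW : (Ein : Set E) ⊆ W := fun e he => Or.inl (Or.inr he)
  have key : ∀ e : Ein, ∃ (w : G.Walk) (n : ℕ), (∀ k < n, f^[k] e ∉ (Eout : Set E)) ∧
      w.edges.Nodup ∧ (∀ e' ∈ w.edges, e' ∈ W ∧ ∃ j ≤ n, e' = f^[j] e) ∧
      w.edges.head? = some e.1 ∧ ∃ o ∈ Eout, w.edges.getLast? = some o := by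
    rintro ⟨e, he⟩
    have hex : ∃ n, f^[n] e ∈ (Eout : Set E) :=
      exists_iterate_mem_of_injOn hinj hmaps hEinW (Finset.mem_coe.mpr he)
    have hmin : ∀ k < Nat.find hex, f^[k] e ∉ (Eout : Set E) := fun k hk => Nat.find_min hex hk
    have hmemW : ∀ k ≤ Nat.find hex, f^[k] e ∈ W := by
      intro k
      induction k with
      | zero => intro _; exact hEinW he
      | succ k ih =>
        intro hk
        rw [Function.iterate_succ_apply']
        exact (hmaps ⟨ih (by omega), hmin k (by omega)⟩).1
    obtain ⟨w, hw₁, hw₂, hw₃, hw₄⟩ := G.exists_walk_of_seq_of_mem_bdry (X := X)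
      (fun k => f^[k] e) (Nat.find hex)
      (fun j k hj hk h => (iterate_eq_iterate_of_injOn hinj hmaps hEinW he he
        (fun i hi => hmin i (by omega)) (fun i hi => hmin i (by omega)) h).2)
      (fun j hj => by
        simp only [Function.iterate_succ_apply']
        exact hfadj _ (hdiffOut ⟨hmemW j hj.le, hmin j hj⟩))
      (hin he)
    refine ⟨w, Nat.find hex, hmin, hw₁, fun e' he' => ?_, hw₃, _, Nat.find_spec hex, hw₄⟩
    obtain ⟨j, hj, rfl⟩ := hw₂ e' he'
    exact ⟨hmemW j hj, j, hj, rfl⟩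
  choose w n hmin hnodup hedges hhead o ho hlast using key
  have hmeet : ∀ a b : Ein, ∀ e ∈ (w a).edges, e ∈ (w b).edges → a = b := by
    intro a b e ha hb
    obtain ⟨-, i, hi, rfl⟩ := hedges a e ha
    obtain ⟨-, j, hj, hij⟩ := hedges b _ hb
    exact Subtype.ext (iterate_eq_iterate_of_injOn hinj hmaps hEinW a.2 b.2
      (fun k hk => hmin a k (by omega)) (fun k hk => hmin b k (by omega)) hij).1
  have hmemHead : ∀ a : Ein, a.1 ∈ (w a).edges := fun a => List.mem_of_mem_head? (hhead a)
  have hmemLast : ∀ a : Ein, o a ∈ (w a).edges := fun a => List.mem_of_mem_getLast? (hlast a)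
  have hsurj : Function.Surjective fun a => (⟨o a, ho a⟩ : Eout) := by
    refine ((Fintype.bijective_iff_injective_and_card _).mpr ⟨fun a b hab => ?_, ?_⟩).2
    · have hab' : o a = o b := congrArg Subtype.val hab
      exact hmeet a b _ (hmemLast a) (hab' ▸ hmemLast b)
    · simp [hcardin, hcardout]
  let φ : Ein ≃ Fin ℓ := Ein.equivFinOfCardEq hcardin
  have hunique : ∀ a : Ein, ∀ e ∈ (w a).edges, ∃! i, e ∈ (w (φ.symm i)).edges := by
    intro a e he
    refine ⟨φ a, by simpa using he, fun i hi => ?_⟩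
    rw [← hmeet _ _ _ hi he, Equiv.apply_symm_apply]
  refine ⟨fun i => w (φ.symm i), fun i => ?_, fun i e he => ?_, fun i => hnodup _,
    fun i j hij e hi hj => hij (φ.symm.injective (hmeet _ _ e hi hj)),
    fun e he => hunique ⟨e, he⟩ e (hmemHead ⟨e, he⟩), fun e he => ?_⟩
  · have hne := List.ne_nil_of_mem (hmemHead (φ.symm i))
    have h₁ := hhead (φ.symm i)
    have h₂ := hlast (φ.symm i)
    rw [List.head?_eq_some_head hne, Option.some_inj] at h₁
    rw [List.getLast?_eq_some_getLast hne, Option.some_inj] at h₂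
    exact ⟨hne, h₁ ▸ (φ.symm i).2, h₂ ▸ ho _⟩
  · rcases (hedges _ e he).1 with (h | h) | h
    exacts [Or.inl h, Or.inr (hin h), Or.inr (hout h)]
  · obtain ⟨a, ha⟩ := hsurj ⟨e, he⟩
    obtain rfl : o a = e := congrArg Subtype.val ha
    exact hunique a _ (hmemLast a)
end
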